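/- Let X be a compact metric space, f a homeomorphism of X, and μ an f-invariant Borel probability measure on X. Then the measure on the suspension (X × R)/A_f obtained as the pushforward of μ ⊗ Leb restricted to X × [0,1) is invariant under the suspension R-action; conversely every finite invariant measure of the suspension flow arises this way from an f-invariant measure on X. -/

import Mathlib

open MeasureTheory

/-- The orbit equivalence relation of the `ℤ`-action generated by
`A_f(x, t) = (f x, t - 1)` on `X × ℝ`. -/
def suspRel {X : Type*} [TopologicalSpace X] (f : X ≃ₜ X) (p q : X × ℝ) : Prop :=
  ∃ n : ℤ, q.1 = ((f.toEquiv : Equiv.Perm X) ^ n) p.1 ∧ q.2 = p.2 - n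

/-- The suspension (mapping torus) of a homeomorphism `f` of `X`. -/
def Susp {X : Type*} [TopologicalSpace X] (f : X ≃ₜ X) : Type _ :=
  Quot (suspRel f)

instance {X : Type*} [TopologicalSpace X] (f : X ≃ₜ X) :
    TopologicalSpace (Susp f) :=
  instTopologicalSpaceQuot

/-- The suspension flow `t · [x, s] = [x, s + t]` on the suspension of `f`. -/
def suspFlow {X : Type*} [TopologicalSpace X] (f : X ≃ₜ X) (t : ℝ) :
    Susp f → Susp f :=
  Quot.map (fun p => (p.1, p.2 + t)) (by
    rintro ⟨x, s⟩ ⟨y, u⟩ ⟨n, h1, h2⟩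
    exact ⟨n, h1, by simp only at h2 ⊢; rw [h2]; ring⟩)

/-- The measure on the suspension obtained from a measure `μ` on `X` by pushing
forward `μ ⊗ Leb` restricted to `X × [0, 1)`. -/
noncomputable def suspMeasure {X : Type*} [TopologicalSpace X]
    [MeasurableSpace X] (f : X ≃ₜ X) [MeasurableSpace (Susp f)]
    (μ : Measure X) : Measure (Susp f) :=
  Measure.map (Quot.mk (suspRel f))
    ((μ.prod volume).restrict (Set.univ ×ˢ Set.Ico (0 : ℝ) 1))

section Susp

variable {X : Type*} [TopologicalSpace X] (f : X ≃ₜ X)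

/-- The `n`-th iterate of the deck transformation `A_f`. -/
def suspDeck (n : ℤ) (p : X × ℝ) : X × ℝ :=
  (((f.toEquiv : Equiv.Perm X) ^ n) p.1, p.2 - n)

lemma continuous_perm_zpow (n : ℤ) : Continuous ((f.toEquiv : Equiv.Perm X) ^ n) := by
  let φ : (X ≃ₜ X) →* Equiv.Perm X :=
    { toFun := Homeomorph.toEquiv, map_one' := rfl, map_mul' := fun _ _ => rfl }
  have h : (f.toEquiv : Equiv.Perm X) ^ n = (f ^ n).toEquiv := (map_zpow φ f n).symm
  rw [h]
  exact (f ^ n).continuous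

lemma continuous_suspDeck (n : ℤ) : Continuous (suspDeck f n) :=
  ((continuous_perm_zpow f n).comp continuous_fst).prodMk (by fun_prop)

lemma suspDeck_suspDeck (m n : ℤ) (p : X × ℝ) :
    suspDeck f m (suspDeck f n p) = suspDeck f (m + n) p := by
  refine Prod.ext ?_ ?_
  · simp [suspDeck, zpow_add]
  · simp only [suspDeck]
    push_cast
    ring

lemma suspDeck_zero (p : X × ℝ) : suspDeck f 0 p = p := by
  simp [suspDeck]

lemma suspRel_iff (p q : X × ℝ) : suspRel f p q ↔ ∃ n : ℤ, q = suspDeck f n p := by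
  simp [suspRel, suspDeck, Prod.ext_iff]

lemma suspRel_equivalence : Equivalence (suspRel f) where
  refl p := (suspRel_iff f p p).2 ⟨0, (suspDeck_zero f p).symm⟩
  symm {p q} h := by
    obtain ⟨n, rfl⟩ := (suspRel_iff f p q).1 h
    exact (suspRel_iff f _ _).2 ⟨-n, by rw [suspDeck_suspDeck]; simp [suspDeck_zero]⟩
  trans {p q r} h h' := by
    obtain ⟨n, rfl⟩ := (suspRel_iff f _ _).1 h
    obtain ⟨m, rfl⟩ := (suspRel_iff f _ _).1 h'
    exact (suspRel_iff f _ _).2 ⟨m + n, suspDeck_suspDeck f m n p⟩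

/-- The quotient projection onto the suspension. -/
def suspProj (p : X × ℝ) : Susp f := Quot.mk (suspRel f) p

lemma suspProj_eq_iff (p q : X × ℝ) :
    suspProj f p = suspProj f q ↔ ∃ n : ℤ, q = suspDeck f n p := by
  rw [← suspRel_iff, ← (suspRel_equivalence f).eqvGen_iff]
  exact Quot.eq

lemma suspProj_suspDeck (n : ℤ) (p : X × ℝ) :
    suspProj f (suspDeck f n p) = suspProj f p :=
  ((suspProj_eq_iff f _ _).2 ⟨n, rfl⟩).symm

lemma suspFlow_suspProj (t : ℝ) (p : X × ℝ) :
    suspFlow f t (suspProj f p) = suspProj f (p.1, p.2 + t) := rfl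

lemma isQuotientMap_suspProj : Topology.IsQuotientMap (suspProj f) := isQuotientMap_quot_mk

lemma isOpenMap_suspProj : IsOpenMap (suspProj f) := by
  intro U hU
  rw [← (isQuotientMap_suspProj f).isOpen_preimage]
  have h : suspProj f ⁻¹' (suspProj f '' U) = ⋃ n : ℤ, suspDeck f n ⁻¹' U := by
    ext p
    simp only [Set.mem_preimage, Set.mem_image, Set.mem_iUnion]
    constructor
    · rintro ⟨q, hq, h⟩
      obtain ⟨n, rfl⟩ := (suspProj_eq_iff f _ _).1 h.symm
      exact ⟨n, hq⟩
    · rintro ⟨n, hn⟩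
      exact ⟨_, hn, suspProj_suspDeck f n p⟩
  rw [h]
  exact isOpen_iUnion fun n => hU.preimage (continuous_suspDeck f n)

lemma continuous_suspFlow (t : ℝ) : Continuous (suspFlow f t) := by
  rw [(isQuotientMap_suspProj f).continuous_iff]
  have : suspFlow f t ∘ suspProj f = fun p => suspProj f (p.1, p.2 + t) := rfl
  rw [this]
  exact (isQuotientMap_suspProj f).continuous.comp (by fun_prop)

lemma measurable_suspFlow [MeasurableSpace (Susp f)] [BorelSpace (Susp f)] (t : ℝ) :
    Measurable (suspFlow f t) :=
  (continuous_suspFlow f t).measurable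

/-- The section of `suspProj` with values in the fundamental domain `X × [0, 1)`. -/
noncomputable def suspSection : Susp f → X × ℝ :=
  Quot.lift (fun p => suspDeck f ⌊p.2⌋ p) (by
    intro p q h
    obtain ⟨n, rfl⟩ := (suspRel_iff f _ _).1 h
    have h2 : ⌊(suspDeck f n p).2⌋ = ⌊p.2⌋ - n := by simp [suspDeck]
    simp only [h2, suspDeck_suspDeck, sub_add_cancel])

lemma suspSection_suspProj (p : X × ℝ) :
    suspSection f (suspProj f p) = suspDeck f ⌊p.2⌋ p := rfl

lemma suspSection_suspProj_of_mem {p : X × ℝ} (hp : p.2 ∈ Set.Ico (0 : ℝ) 1) :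
    suspSection f (suspProj f p) = p := by
  rw [suspSection_suspProj, Int.floor_eq_zero_iff.2 hp, suspDeck_zero]

lemma suspProj_suspSection (y : Susp f) : suspProj f (suspSection f y) = y := by
  obtain ⟨p, rfl⟩ := (isQuotientMap_suspProj f).surjective y
  rw [suspSection_suspProj, suspProj_suspDeck]

lemma suspSection_snd_suspProj (p : X × ℝ) :
    (suspSection f (suspProj f p)).2 = Int.fract p.2 := rfl

lemma suspSection_snd_mem (y : Susp f) : (suspSection f y).2 ∈ Set.Ico (0 : ℝ) 1 := by
  obtain ⟨p, rfl⟩ := (isQuotientMap_suspProj f).surjective y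
  exact ⟨Int.fract_nonneg _, Int.fract_lt_one _⟩

lemma isClosed_suspSection_snd_eq_zero : IsClosed {y : Susp f | (suspSection f y).2 = 0} := by
  rw [← (isQuotientMap_suspProj f).isClosed_preimage]
  have h : suspProj f ⁻¹' {y | (suspSection f y).2 = 0}
      = Prod.snd ⁻¹' Set.range (Int.cast : ℤ → ℝ) := by
    ext p
    simp [suspSection_snd_suspProj, Int.fract_eq_zero_iff]
  rw [h]
  exact Int.isClosedEmbedding_coe_real.isClosed_range.preimage continuous_snd

lemma suspSection_preimage (B : Set (X × ℝ)) :
    suspSection f ⁻¹' B = suspProj f '' (B ∩ Prod.snd ⁻¹' Set.Ioo 0 1) ∪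
      (suspProj f '' ((fun p => (p.1, (0 : ℝ))) ⁻¹' B ∩ Prod.snd ⁻¹' Set.Ioo (-1) 1) ∩
        {y | (suspSection f y).2 = 0}) := by
  ext y
  constructor
  · intro hy
    have hy2 := suspSection_snd_mem f y
    rcases hy2.1.eq_or_lt with h0 | h0
    · right
      refine ⟨⟨suspSection f y, ⟨?_, ?_⟩, suspProj_suspSection f y⟩, h0.symm⟩
      · have : ((suspSection f y).1, (0 : ℝ)) = suspSection f y := Prod.ext rfl h0
        simpa only [Set.mem_preimage, this] using hy
      · simp [← h0]
    · exact Or.inl ⟨suspSection f y, ⟨hy, h0, hy2.2⟩, suspProj_suspSection f y⟩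
  · rintro (⟨q, ⟨hq, hq2⟩, rfl⟩ | ⟨⟨q, ⟨hq, hq2⟩, rfl⟩, h0⟩)
    · rw [Set.mem_preimage, suspSection_suspProj_of_mem f (Set.Ioo_subset_Ico_self hq2)]
      exact hq
    · have hz : q.2 = 0 := by
        obtain ⟨n, hn⟩ := Int.fract_eq_zero_iff.1 ((suspSection_snd_suspProj f q).symm.trans h0)
        have h1 : -1 < q.2 := hq2.1
        have h2 : q.2 < 1 := hq2.2
        rw [← hn] at h1 h2 ⊢
        have h1 : -1 < n := by exact_mod_cast h1
        have h2 : n < 1 := by exact_mod_cast h2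
        have : n = 0 := by omega
        simp [this]
      have hq' : (q.1, (0 : ℝ)) = q := Prod.ext rfl hz.symm
      rw [Set.mem_preimage, suspSection_suspProj_of_mem f (by simp [hz]), ← hq']
      exact hq

lemma exists_suspDeck_suspSection (p : X × ℝ) :
    ∃ k : ℤ, p = suspDeck f k (suspSection f (suspProj f p)) :=
  (suspProj_eq_iff f _ _).1 (suspProj_suspSection f _)

lemma tsum_indicator_suspDeck_suspSection (S : Set (X × ℝ)) (p : X × ℝ) :
    ∑' n : ℤ, S.indicator (1 : X × ℝ → ENNReal) (suspDeck f n (suspSection f (suspProj f p))) =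
      ∑' n : ℤ, S.indicator (1 : X × ℝ → ENNReal) (suspDeck f n p) := by
  obtain ⟨k, hk⟩ := exists_suspDeck_suspSection f p
  have h (n : ℤ) : suspDeck f n p = suspDeck f (n + k) (suspSection f (suspProj f p)) := by
    conv_lhs => rw [hk, suspDeck_suspDeck]
  simp_rw [h]
  exact ((Equiv.addRight k).tsum_eq
    (fun n => S.indicator (1 : X × ℝ → ENNReal)
      (suspDeck f n (suspSection f (suspProj f p))))).symm

lemma suspDeck_add (n : ℤ) (p : X × ℝ) (t : ℝ) :
    suspDeck f n (p.1, p.2 + t) = ((suspDeck f n p).1, (suspDeck f n p).2 + t) := by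
  simp only [suspDeck, Prod.mk.injEq, true_and]
  ring

lemma suspSection_fst_suspFlow_one (y : Susp f) :
    (suspSection f (suspFlow f 1 y)).1 = f (suspSection f y).1 := by
  obtain ⟨p, rfl⟩ := (isQuotientMap_suspProj f).surjective y
  simp [suspFlow_suspProj, suspSection_suspProj, suspDeck, add_comm _ (1 : ℤ), zpow_add]

end Susp

section Measure

variable {X : Type*} [TopologicalSpace X] [MeasurableSpace X] [BorelSpace X]
  (f : X ≃ₜ X)

lemma measurable_suspDeck (n : ℤ) : Measurable (suspDeck f n) :=
  (continuous_suspDeck f n).measurable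

variable [MeasurableSpace (Susp f)] [BorelSpace (Susp f)]

lemma measurable_suspProj : Measurable (suspProj f) :=
  (isQuotientMap_suspProj f).continuous.measurable

lemma measurable_suspSection : Measurable (suspSection f) := by
  refine measurable_of_isOpen fun B hB => ?_
  rw [suspSection_preimage]
  refine ((isOpenMap_suspProj f _ ?_).measurableSet).union
    ((isOpenMap_suspProj f _ ?_).measurableSet.inter
      (isClosed_suspSection_snd_eq_zero f).measurableSet)
  · exact hB.inter (isOpen_Ioo.preimage continuous_snd)
  · exact (hB.preimage (by fun_prop)).inter (isOpen_Ioo.preimage continuous_snd)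

lemma suspMeasure_apply (μ : Measure X) [SFinite μ] {S : Set (Susp f)} (hS : MeasurableSet S) :
    suspMeasure f μ S = ∫⁻ s in Set.Ico (0 : ℝ) 1, μ {x | suspProj f (x, s) ∈ S} := by
  have h : suspMeasure f μ =
      Measure.map (suspProj f) (μ.prod (volume.restrict (Set.Ico (0 : ℝ) 1))) := by
    conv_rhs => rw [← Measure.restrict_univ (μ := μ), Measure.prod_restrict]
    rfl
  rw [h, Measure.map_apply (measurable_suspProj f) hS,
    Measure.prod_apply_symm (measurable_suspProj f hS)]
  rfl

theorem map_suspFlow_suspMeasure (μ : Measure X) [SFinite μ] (hμ : Measure.map f μ = μ) (t : ℝ) :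
    Measure.map (suspFlow f t) (suspMeasure f μ) = suspMeasure f μ := by
  ext S hS
  rw [Measure.map_apply (measurable_suspFlow f t) hS,
    suspMeasure_apply f μ (measurable_suspFlow f t hS), suspMeasure_apply f μ hS]
  set h : ℝ → ENNReal := fun s => μ {x | suspProj f (x, s) ∈ S} with h_def
  have hper : Function.Periodic h 1 := by
    intro s
    have hms : MeasurableSet {x | suspProj f (x, s) ∈ S} :=
      ((measurable_suspProj f).comp (by fun_prop : Measurable fun x : X => (x, s))) hS
    have h1 : h s = Measure.map f μ {x | suspProj f (x, s) ∈ S} := by rw [hμ]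
    rw [h1, Measure.map_apply f.continuous.measurable hms]
    simp only [h_def]
    congr 1
    ext x
    have : suspDeck f 1 (x, s + 1) = (f x, s) := by simp [suspDeck]
    simp only [Set.mem_ofPred_eq, Set.mem_preimage, ← this, suspProj_suspDeck]
  change ∫⁻ s in Set.Ico (0 : ℝ) 1, h (s + t) = ∫⁻ s in Set.Ico (0 : ℝ) 1, h s
  rw [restrict_Ico_eq_restrict_Ioc]
  have htr : ∫⁻ s in Set.Ioc (0 : ℝ) 1, h (s + t) = ∫⁻ s in Set.Ioc t (t + 1), h s := by
    have := (measurePreserving_add_right volume t).setLIntegral_comp_preimage_emb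
      (measurableEmbedding_addRight t) h (Set.Ioc t (t + 1))
    rw [← this]
    simp
  rw [htr]
  have := (isAddFundamentalDomain_Ioc one_pos t).setLIntegral_eq
    (isAddFundamentalDomain_Ioc one_pos (0 : ℝ)) h (by
      rintro ⟨_, n, rfl⟩ s
      exact (congrArg h (add_comm _ _)).trans (hper.zsmul n s))
  simpa using this

/-- The lift to `X × ℝ` of a measure on the suspension. -/
noncomputable def suspLift (ν : Measure (Susp f)) : Measure (X × ℝ) :=
  Measure.sum fun n : ℤ => Measure.map (suspDeck f n ∘ suspSection f) ν

lemma suspLift_apply (ν : Measure (Susp f)) {S : Set (X × ℝ)} (hS : MeasurableSet S) :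
    suspLift f ν S = ∫⁻ y, ∑' n : ℤ,
      S.indicator (1 : X × ℝ → ENNReal) (suspDeck f n (suspSection f y)) ∂ν := by
  have hm (n : ℤ) : Measurable (suspDeck f n ∘ suspSection f) :=
    (measurable_suspDeck f n).comp (measurable_suspSection f)
  rw [suspLift, Measure.sum_apply _ hS, lintegral_tsum]
  · refine tsum_congr fun n => ?_
    rw [Measure.map_apply (hm n) hS, ← lintegral_indicator_one (hm n hS)]
    rfl
  · intro n
    exact ((measurable_one.indicator hS).comp (hm n)).aemeasurable

lemma suspLift_preimage_add (ν : Measure (Susp f)) {t : ℝ}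
    (hν : Measure.map (suspFlow f t) ν = ν) {S : Set (X × ℝ)} (hS : MeasurableSet S) :
    suspLift f ν ((fun p => (p.1, p.2 + t)) ⁻¹' S) = suspLift f ν S := by
  rw [suspLift_apply f ν hS, suspLift_apply f ν ((by fun_prop :
    Measurable fun p : X × ℝ => (p.1, p.2 + t)) hS)]
  conv_rhs => rw [← hν]
  rw [lintegral_map _ (measurable_suspFlow f t)]
  · refine lintegral_congr fun y => ?_
    obtain ⟨p, rfl⟩ := (isQuotientMap_suspProj f).surjective y
    rw [suspFlow_suspProj, tsum_indicator_suspDeck_suspSection,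
      tsum_indicator_suspDeck_suspSection]
    refine tsum_congr fun n => ?_
    rw [suspDeck_add]
    rfl
  · exact Measurable.tsum fun n => (measurable_one.indicator hS).comp
      ((measurable_suspDeck f n).comp (measurable_suspSection f))

lemma suspLift_eq_of_subset (ν : Measure (Susp f)) {S : Set (X × ℝ)} (hS : MeasurableSet S)
    (hS' : S ⊆ Prod.snd ⁻¹' Set.Ico (0 : ℝ) 1) :
    suspLift f ν S = ν (suspSection f ⁻¹' S) := by
  rw [suspLift_apply f ν hS, ← lintegral_indicator_one (measurable_suspSection f hS)]
  refine lintegral_congr fun y => ?_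
  rw [tsum_eq_single 0]
  · rw [suspDeck_zero]
    rfl
  · intro n hn
    refine Set.indicator_of_notMem (fun hmem => hn ?_) _
    have h1 : ⌊(suspDeck f n (suspSection f y)).2⌋ = 0 := Int.floor_eq_zero_iff.2 (hS' hmem)
    have h2 : ⌊(suspSection f y).2⌋ = 0 := Int.floor_eq_zero_iff.2 (suspSection_snd_mem f y)
    simp only [suspDeck, Int.floor_sub_intCast, h2] at h1
    omega

lemma map_suspSection_eq_prod (ν : Measure (Susp f)) [IsFiniteMeasure ν]
    (hν : ∀ t : ℝ, Measure.map (suspFlow f t) ν = ν) :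
    Measure.map (suspSection f) ν =
      (Measure.map (fun y => (suspSection f y).1) ν).prod
        (volume.restrict (Set.Ico (0 : ℝ) 1)) := by
  have hσ := measurable_suspSection f
  symm
  refine Measure.prod_eq fun V B hV hB => ?_
  -- the fibre measure over `V` is translation invariant on the line
  set m : Measure ℝ := Measure.map Prod.snd ((suspLift f ν).restrict (Prod.fst ⁻¹' V)) with hm
  have hm_apply {C : Set ℝ} (hC : MeasurableSet C) : m C = suspLift f ν (V ×ˢ C) := by
    rw [hm, Measure.map_apply measurable_snd hC, Measure.restrict_apply (measurable_snd hC),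
      Set.inter_comm]
    rfl
  have hm_Ico {C : Set ℝ} (hC : MeasurableSet C) (hC' : C ⊆ Set.Ico 0 1) :
      m C = ν (suspSection f ⁻¹' (V ×ˢ C)) := by
    rw [hm_apply hC, suspLift_eq_of_subset f ν (hV.prod hC) fun p hp => hC' hp.2]
  have hm_add (t : ℝ) {C : Set ℝ} (hC : MeasurableSet C) : m ((fun s => t + s) ⁻¹' C) = m C := by
    rw [hm_apply hC, hm_apply (measurable_const_add t hC),
      ← suspLift_preimage_add f ν (hν t) (hV.prod hC)]
    congr 1
    ext p
    simp [add_comm]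
  have : m.IsAddLeftInvariant := ⟨fun t => by
    ext C hC
    rw [Measure.map_apply (by fun_prop) hC, hm_add t hC]⟩
  have : IsLocallyFiniteMeasure m := ⟨fun x => by
    refine ⟨Set.Ioo (x - 1 / 2) (x + 1 / 2), Ioo_mem_nhds (by linarith) (by linarith), ?_⟩
    rw [← hm_add (x - 1 / 2) measurableSet_Ioo]
    refine (measure_mono (t := Set.Ico 0 1) ?_).trans_lt ?_
    · rintro s ⟨h1, h2⟩
      constructor <;> linarith
    · rw [hm_Ico measurableSet_Ico subset_rfl]
      exact measure_lt_top _ _⟩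
  obtain ⟨c, hsmul⟩ : ∃ c : NNReal, m = c • (volume : Measure ℝ) :=
    ⟨_, Measure.isAddLeftInvariant_eq_smul m volume⟩
  have hc : (c : ENNReal) = Measure.map (fun y => (suspSection f y).1) ν V := by
    have h1 : m (Set.Ico 0 1) = c := by
      rw [hsmul, Measure.smul_apply, ENNReal.smul_def, smul_eq_mul]
      simp
    rw [← h1, hm_Ico measurableSet_Ico subset_rfl, Measure.map_apply hσ.fst hV]
    congr 1
    ext y
    simpa using fun _ => suspSection_snd_mem f y
  have hB' : m (B ∩ Set.Ico 0 1) = c * volume (B ∩ Set.Ico 0 1) := by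
    rw [hsmul, Measure.smul_apply, ENNReal.smul_def, smul_eq_mul]
  rw [← hc, Measure.restrict_apply hB, ← hB', hm_Ico (hB.inter measurableSet_Ico)
    Set.inter_subset_right, Measure.map_apply hσ (hV.prod hB)]
  congr 1
  ext y
  have := suspSection_snd_mem f y
  simp only [Set.mem_preimage, Set.mem_prod, Set.mem_inter_iff]
  tauto

end Measure

/-- For an `f`-invariant Borel probability measure `μ` on a compact metric
space `X`, the pushforward of `μ ⊗ Leb|_{X × [0,1)}` to the suspension is
invariant under the suspension flow; conversely, every finite flow-invariant
measure on the suspension arises this way from a finite `f`-invariant measure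
on `X`. -/
theorem stmt13 {X : Type*} [MetricSpace X] [CompactSpace X]
    [MeasurableSpace X] [BorelSpace X] (f : X ≃ₜ X)
    [MeasurableSpace (Susp f)] [BorelSpace (Susp f)]
    (μ : Measure X) [IsProbabilityMeasure μ]
    (hμ : Measure.map f μ = μ) :
    (∀ t : ℝ, Measure.map (suspFlow f t) (suspMeasure f μ) = suspMeasure f μ) ∧
    (∀ ν : Measure (Susp f), IsFiniteMeasure ν →
      (∀ t : ℝ, Measure.map (suspFlow f t) ν = ν) →
      ∃ μ' : Measure X, IsFiniteMeasure μ' ∧ Measure.map f μ' = μ' ∧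
        ν = suspMeasure f μ') := by
  refine ⟨map_suspFlow_suspMeasure f μ hμ, fun ν _ hν => ?_⟩
  have hσ := measurable_suspSection f
  refine ⟨Measure.map (fun y => (suspSection f y).1) ν, inferInstance, ?_, ?_⟩
  · rw [Measure.map_map f.continuous.measurable hσ.fst]
    conv_rhs => rw [← hν 1, Measure.map_map hσ.fst (measurable_suspFlow f 1)]
    congr 1
    ext y
    exact (suspSection_fst_suspFlow_one f y).symm
  · rw [suspMeasure, ← Measure.prod_restrict, Measure.restrict_univ,
      ← map_suspSection_eq_prod f ν hν]
    change ν = Measure.map (suspProj f) _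
    rw [Measure.map_map (measurable_suspProj f) hσ]
    have : suspProj f ∘ suspSection f = id := funext (suspProj_suspSection f)
    rw [this, Measure.map_id]
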